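/- Let f : ℝᵐ → ℝ be a C¹-smooth Lipschitz function which is not constant on any proper coordinate subspace, i.e. for every nonempty proper subset σ of {1, …, m} the restriction of f to span{eᵢ : i ∈ σ} is not constant. Then there exist λ₁, …, λ_m > 0 with λ₁² + ⋯ + λ_m² = 1 such that, with Λ = diag(λ₁, …, λ_m), ‖∂ⱼ(f∘Λ)‖_{L¹(γ_m)} ≤ (1/m) · a(f∘Λ) for every j = 1, …, m, where a(g) denotes the Lipschitz constant of g with respect to ‖·‖_∞. -/

import Mathlib

open MeasureTheory ProbabilityTheory Real

/-- The standard Gaussian measure `γ_m` on `ℝᵐ`. -/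
noncomputable def stdGaussian (m : ℕ) : Measure (Fin m → ℝ) :=
  Measure.pi fun _ => gaussianReal 0 1

/-- The Euclidean norm on `ℝᵐ`. -/
noncomputable def euclNorm {m : ℕ} (x : Fin m → ℝ) : ℝ :=
  Real.sqrt (∑ i, (x i) ^ 2)

/-- The `i`-th partial derivative of `f : ℝᵐ → ℝ` (via the Fréchet derivative). -/
noncomputable def partialDeriv {m : ℕ} (f : (Fin m → ℝ) → ℝ) (i : Fin m)
    (x : Fin m → ℝ) : ℝ :=
  fderiv ℝ f x (Pi.single i 1)

/-- `a(g)`: the Lipschitz constant of `g : ℝᵐ → ℝ` with respect to the sup norm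
`‖·‖_∞` (which is the norm of the pi type `Fin m → ℝ`). -/
noncomputable def lipConstInf {m : ℕ} (g : (Fin m → ℝ) → ℝ) : ℝ :=
  sInf {t | 0 < t ∧ ∀ x y, |g x - g y| ≤ t * ‖x - y‖}

section Combinatorial

variable {I X α : Type*} [LinearOrder α]

/-- A finite set `σ` is dominating for the family of orders `h` if every point lies below all of
`σ` in at least one of the orders. -/
def Dominating (h : I → X → α) (σ : Finset X) : Prop :=
  ∀ y, ∃ i, ∀ x ∈ σ, h i y ≤ h i x

lemma Dominating.mono {h : I → X → α} {σ τ : Finset X} (hσ : Dominating h σ) (hτ : τ ⊆ σ) :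
    Dominating h τ := fun y => (hσ y).imp fun _ hi x hx => hi x (hτ hx)

variable [Fintype I] [DecidableEq I] [DecidableEq X]

/-- `y` is the largest point, in the order `k`, among those exceeding `p i` in each order
`i ≠ k`. -/
def IsTopAbove (h : I → X → α) (p : I → X) (k : I) (y : X) : Prop :=
  (∀ i, i ≠ k → h i (p i) < h i y) ∧
    ∀ z, (∀ i, i ≠ k → h i (p i) < h i z) → h k z ≤ h k y

lemma isTopAbove_of_dominating_insert {h : I → X → α} (hinj : ∀ i, Function.Injective (h i))
    {τ : Finset X} (hcard : τ.card + 1 = Fintype.card I) {p : I → X} (hpτ : ∀ i, p i ∈ τ)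
    (hp : ∀ i, ∀ x ∈ τ, h i (p i) ≤ h i x) {a b : I} (hab : a ≠ b) (hpab : p a = p b) {y : X}
    (hy : y ∉ τ) (hdom : Dominating h (insert y τ)) :
    IsTopAbove h p a y ∨ IsTopAbove h p b y := by
  have hmin : ∀ i, ∀ x ∈ τ, (∀ x' ∈ τ, h i x ≤ h i x') → x = p i := fun i x hx hx' =>
    hinj i (le_antisymm (hx' _ (hpτ i)) (hp i x hx))
  choose q hq using hdom
  have hqinj : Function.Injective fun x : (insert y τ : Finset X) => q x := by
    intro x x' hxx
    have h1 := hq x x' x'.2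
    have h2 := hq x' x x.2
    simp only at hxx
    rw [← hxx] at h2
    exact Subtype.ext (hinj _ (le_antisymm h1 h2))
  have hqsurj : Function.Surjective fun x : (insert y τ : Finset X) => q x := by
    refine ((Fintype.bijective_iff_injective_and_card _).2 ⟨hqinj, ?_⟩).2
    rw [Fintype.card_coe, Finset.card_insert_of_notMem hy, hcard]
  have key : ∀ i, i ≠ q y → h i (p i) < h i y := by
    intro i hi
    obtain ⟨⟨x, hx⟩, rfl⟩ := hqsurj i
    have hxy : x ≠ y := by rintro rfl; exact hi rfl
    have hxτ : x ∈ τ := (Finset.mem_insert.1 hx).resolve_left hxy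
    have hxp : x = p (q x) := hmin _ x hxτ fun x' hx' => hq x x' (Finset.mem_insert_of_mem hx')
    simp only [← hxp]
    exact lt_of_le_of_ne (hq x y (Finset.mem_insert_self _ _)) fun e => hxy (hinj _ e)
  have htop : IsTopAbove h p (q y) y := by
    refine ⟨key, fun z hz => ?_⟩
    have : q z = q y := by
      by_contra hne
      exact absurd (hq z (p (q z)) (Finset.mem_insert_of_mem (hpτ _))) (not_le.2 (hz _ hne))
    rw [← this]
    exact hq z y (Finset.mem_insert_self _ _)
  obtain ⟨⟨x, hx⟩, hxa⟩ := hqsurj a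
  obtain ⟨⟨x', hx'⟩, hxb⟩ := hqsurj b
  simp only at hxa hxb
  by_cases hxy : x = y
  · left; rw [hxy] at hxa; rwa [hxa] at htop
  by_cases hxy' : x' = y
  · right; rw [hxy'] at hxb; rwa [hxb] at htop
  have e1 : x = p (q x) := hmin _ x ((Finset.mem_insert.1 hx).resolve_left hxy)
    fun z hz => hq x z (Finset.mem_insert_of_mem hz)
  have e2 : x' = p (q x') := hmin _ x' ((Finset.mem_insert.1 hx').resolve_left hxy')
    fun z hz => hq x' z (Finset.mem_insert_of_mem hz)
  rw [hxa] at e1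
  rw [hxb] at e2
  have : x = x' := by rw [e1, e2, hpab]
  exact absurd (by rw [← hxa, ← hxb, this]) hab

lemma IsTopAbove.dominating_insert {h : I → X → α}
    {τ : Finset X} {p : I → X} (hpτ : ∀ i, p i ∈ τ)
    (hp : ∀ i, ∀ x ∈ τ, h i (p i) ≤ h i x) (hsurj : ∀ x ∈ τ, ∃ i, p i = x) (hτ : Dominating h τ)
    {a b : I} (hab : a ≠ b) (hpab : p a = p b) {y : X} (hy : IsTopAbove h p a y) :
    y ∉ τ ∧ Dominating h (insert y τ) := by
  constructor
  · intro hyτ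
    obtain ⟨i, rfl⟩ := hsurj y hyτ
    by_cases hi : i = a
    · subst hi
      exact absurd (hy.1 b hab.symm) (by rw [hpab]; exact lt_irrefl _)
    · exact lt_irrefl _ (hy.1 i hi)
  · intro z
    by_cases hz : ∀ i, i ≠ a → h i (p i) < h i z
    · obtain ⟨i, hi⟩ := hτ z
      have hia : i = a := by
        by_contra hne
        exact absurd (hi _ (hpτ i)) (not_le.2 (hz i hne))
      subst hia
      exact ⟨i, Finset.forall_mem_insert _ _ _ |>.2 ⟨hy.2 z hz, hi⟩⟩
    · push Not at hz
      obtain ⟨i, hia, hi⟩ := hz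
      refine ⟨i, Finset.forall_mem_insert _ _ _ |>.2 ⟨hi.trans (hy.1 i hia).le, fun x hx =>
        hi.trans (hp i x hx)⟩⟩

open Classical in
/-- Let `τ` be a dominating set with one point fewer than there are orders. If, for each order `k`,
some point exceeds the minimum of `τ` in all orders but `k`, then the number of ways to extend `τ`
by one point to a dominating set is even. -/
lemma even_card_dominating_insert [Fintype X] {h : I → X → α}
    (hinj : ∀ i, Function.Injective (h i)) {τ : Finset X} (hτ : Dominating h τ)
    (hne : τ.Nonempty) (hcard : τ.card + 1 = Fintype.card I)
    (habove : ∀ p : I → X, (∀ i, p i ∈ τ) → (∀ i, ∀ x ∈ τ, h i (p i) ≤ h i x) →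
      ∀ k, ∃ y, ∀ i, i ≠ k → h i (p i) < h i y) :
    Even (Finset.univ.filter fun y => y ∉ τ ∧ Dominating h (insert y τ)).card := by
  choose p hpτ hp using fun i => τ.exists_min_image (h i) hne
  have hsurj : ∀ x ∈ τ, ∃ i, p i = x := fun x hx =>
    (hτ x).imp fun i hi => hinj i (le_antisymm (hp i x hx) (hi _ (hpτ i)))
  obtain ⟨a, -, b, -, hab, hpab⟩ := Finset.exists_ne_map_eq_of_card_lt_of_maps_to
    (s := Finset.univ) (t := τ) (by rw [Finset.card_univ]; omega) (f := p) (fun i _ => hpτ i)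
  have htop : ∀ k, ∃ y, IsTopAbove h p k y := by
    intro k
    obtain ⟨y₀, hy₀⟩ := habove p hpτ hp k
    obtain ⟨y, hy, hmax⟩ := (Finset.univ.filter fun y => ∀ i, i ≠ k → h i (p i) < h i y)
      |>.exists_max_image (h k) ⟨y₀, by simpa using hy₀⟩
    exact ⟨y, by simpa using hy, fun z hz => hmax z (by simpa using hz)⟩
  have huniq : ∀ k y z, IsTopAbove h p k y → IsTopAbove h p k z → y = z := fun k y z hy hz =>
    hinj k (le_antisymm (hz.2 y hy.1) (hy.2 z hz.1))
  obtain ⟨u, hu⟩ := htop a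
  obtain ⟨v, hv⟩ := htop b
  have huv : u ≠ v := by
    rintro rfl
    obtain ⟨i, hi⟩ := hτ u
    by_cases hia : i = a
    · exact absurd (hi _ (hpτ i)) (not_le.2 (hv.1 i (hia ▸ hab)))
    · exact absurd (hi _ (hpτ i)) (not_le.2 (hu.1 i hia))
  have : (Finset.univ.filter fun y => y ∉ τ ∧ Dominating h (insert y τ)) = {u, v} := by
    ext y
    simp only [Finset.mem_filter, Finset.mem_univ, true_and, Finset.mem_insert,
      Finset.mem_singleton]
    constructor
    · rintro ⟨hy, hd⟩
      exact (isTopAbove_of_dominating_insert hinj hcard hpτ hp hab hpab hy hd).imp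
        (fun h' => huniq a _ _ h' hu) (fun h' => huniq b _ _ h' hv)
    · rintro (rfl | rfl)
      · exact hu.dominating_insert hpτ hp hsurj hτ hab hpab
      · exact hv.dominating_insert hpτ hp hsurj hτ hab.symm hpab.symm
  rw [this, Finset.card_pair huv]
  exact even_two

/-- A non-surjectively coloured set has an even number of facets of a given colour type. -/
lemma even_card_filter_image_erase {c : X → I} {σ : Finset X}
    (hcard : σ.card = Fintype.card I) (hσ : σ.image c ≠ Finset.univ) (i₀ : I) :
    Even (σ.filter fun x => (σ.erase x).image c = Finset.univ.erase i₀).card := by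
  rcases (σ.filter fun x => (σ.erase x).image c = Finset.univ.erase i₀).eq_empty_or_nonempty
    with he | ⟨x, hx⟩
  · rw [he]; exact Even.zero
  rw [Finset.mem_filter] at hx
  obtain ⟨hxσ, hx⟩ := hx
  have hinj : Set.InjOn c (σ.erase x) := by
    apply Finset.injOn_of_card_image_eq
    rw [hx, Finset.card_erase_of_mem (Finset.mem_univ _), Finset.card_erase_of_mem hxσ, hcard,
      Finset.card_univ]
  have hσx : σ.image c = insert (c x) (Finset.univ.erase i₀) := by
    rw [← hx, ← Finset.image_insert, Finset.insert_erase hxσ]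
  have hcx : c x ≠ i₀ := by
    intro h
    rw [h, Finset.insert_erase (Finset.mem_univ _)] at hσx
    exact hσ hσx
  have hmem : c x ∈ (σ.erase x).image c := by
    rw [hx]; exact Finset.mem_erase.2 ⟨hcx, Finset.mem_univ _⟩
  obtain ⟨w, hw, hwx⟩ := Finset.mem_image.1 hmem
  obtain ⟨hwne, hwσ⟩ := Finset.mem_erase.1 hw
  have : (σ.filter fun x => (σ.erase x).image c = Finset.univ.erase i₀) = {x, w} := by
    ext y
    simp only [Finset.mem_filter, Finset.mem_insert, Finset.mem_singleton]
    constructor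
    · rintro ⟨hyσ, hy⟩
      by_contra! hyne
      have hymem : y ∈ σ.erase x := Finset.mem_erase.2 ⟨hyne.1, hyσ⟩
      have : c y ∈ (σ.erase y).image c := by
        rw [hy, ← hx]; exact Finset.mem_image_of_mem _ hymem
      obtain ⟨z, hz, hzy⟩ := Finset.mem_image.1 this
      obtain ⟨hzne, hzσ⟩ := Finset.mem_erase.1 hz
      by_cases hzx : z = x
      · subst hzx
        exact hyne.2 (hinj hymem hw (by rw [hwx, hzy]))
      · exact hzne (hinj (Finset.mem_erase.2 ⟨hzx, hzσ⟩) hymem hzy)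
    · rintro (rfl | rfl)
      · exact ⟨hxσ, hx⟩
      · refine ⟨hwσ, ?_⟩
        have h1 : x ∈ σ.erase y := Finset.mem_erase.2 ⟨hwne.symm, hxσ⟩
        rw [← hx, ← Finset.insert_erase h1, ← Finset.insert_erase hw, Finset.image_insert,
          Finset.image_insert, hwx, Finset.erase_right_comm]
  rw [this, Finset.card_pair hwne.symm]
  exact even_two

/-- **Scarf's lemma** for a set containing a slack point `s i` for each order `i`. -/
lemma exists_dominating_image_eq_univ [Nonempty I] [Fintype X] {h : I → X → α}
    (hinj : ∀ i, Function.Injective (h i)) {s : I → X} (hs : ∀ i y, h i (s i) ≤ h i y)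
    (hs' : ∀ i j y, i ≠ j → y ∉ Set.range s → h i y < h i (s j)) (hT : ∃ t, t ∉ Set.range s)
    {c : X → I} (hc : ∀ i, c (s i) = i) :
    ∃ σ : Finset X, σ.card = Fintype.card I ∧ Dominating h σ ∧ σ.image c = Finset.univ := by
  classical
  by_contra! hcon
  obtain ⟨i₀⟩ := ‹Nonempty I›
  have hsinj : Function.Injective s := Function.LeftInverse.injective hc
  let A : Finset (Finset X × X) := Finset.univ.filter fun q => q.2 ∈ q.1 ∧
    q.1.card = Fintype.card I ∧ Dominating h q.1 ∧ (q.1.erase q.2).image c = Finset.univ.erase i₀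
  let B : Finset (Finset X × X) := Finset.univ.filter fun q => q.2 ∉ q.1 ∧
    q.1.card + 1 = Fintype.card I ∧ Dominating h (insert q.2 q.1) ∧
      q.1.image c = Finset.univ.erase i₀
  have hAB : A.card = B.card := by
    refine Finset.card_nbij' (fun q => (q.1.erase q.2, q.2)) (fun q => (insert q.2 q.1, q.2))
      ?_ ?_ ?_ ?_
    · rintro ⟨σ, x⟩ hq
      simp only [A, B, Finset.coe_filter, Finset.mem_univ, true_and, Set.mem_ofPred_eq] at hq ⊢
      refine ⟨Finset.notMem_erase _ _, ?_, ?_, hq.2.2.2⟩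
      · rw [Finset.card_erase_add_one hq.1, hq.2.1]
      · rw [Finset.insert_erase hq.1]; exact hq.2.2.1
    · rintro ⟨τ, x⟩ hq
      simp only [A, B, Finset.coe_filter, Finset.mem_univ, true_and, Set.mem_ofPred_eq] at hq ⊢
      refine ⟨Finset.mem_insert_self _ _, ?_, hq.2.2.1, ?_⟩
      · rw [Finset.card_insert_of_notMem hq.1, hq.2.1]
      · rw [Finset.erase_insert hq.1]; exact hq.2.2.2
    · rintro ⟨σ, x⟩ hq
      simp only [A, Finset.coe_filter, Finset.mem_univ, true_and, Set.mem_ofPred_eq] at hq ⊢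
      rw [Finset.insert_erase hq.1]
    · rintro ⟨τ, x⟩ hq
      simp only [B, Finset.coe_filter, Finset.mem_univ, true_and, Set.mem_ofPred_eq] at hq ⊢
      rw [Finset.erase_insert hq.1]
  have hA : Even A.card := by
    rw [Finset.card_eq_sum_card_fiberwise (f := Prod.fst) (t := Finset.univ) (by simp)]
    refine Finset.even_sum _ fun σ _ => ?_
    by_cases hσ : σ.card = Fintype.card I ∧ Dominating h σ
    · refine Eq.subst (motive := Even) (Eq.symm ?_)
        (even_card_filter_image_erase hσ.1 (hcon σ hσ.1 hσ.2) i₀)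
      refine Finset.card_nbij' Prod.snd (fun x => (σ, x)) ?_ ?_ ?_ ?_
      · rintro ⟨σ', x⟩ hq
        simp only [A, Finset.coe_filter, Finset.mem_filter, Finset.mem_univ, true_and,
          Set.mem_ofPred_eq] at hq ⊢
        obtain ⟨hq, rfl⟩ := hq
        exact ⟨hq.1, hq.2.2.2⟩
      · intro x hx
        simp only [A, Finset.coe_filter, Finset.mem_filter, Finset.mem_univ, true_and,
          Set.mem_ofPred_eq] at hx ⊢
        exact ⟨⟨hx.1, hσ.1, hσ.2, hx.2⟩, trivial⟩
      · rintro ⟨σ', x⟩ hq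
        simp only [Finset.coe_filter, Set.mem_ofPred_eq] at hq ⊢
        rw [hq.2]
      · intro x hx; rfl
    · suffices A.filter (fun q => q.1 = σ) = ∅ by rw [this]; exact Even.zero
      rw [Finset.filter_eq_empty_iff]
      rintro ⟨σ', x⟩ hq rfl
      simp only [A, Finset.mem_filter, Finset.mem_univ, true_and] at hq
      exact hσ ⟨hq.2.1, hq.2.2.1⟩
  let τ₀ : Finset X := (Finset.univ.erase i₀).image s
  have hτ₀card : τ₀.card + 1 = Fintype.card I := by
    rw [Finset.card_image_of_injective _ hsinj, Finset.card_erase_add_one (Finset.mem_univ _),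
      Finset.card_univ]
  have hτ₀c : τ₀.image c = Finset.univ.erase i₀ := by
    rw [Finset.image_image, show c ∘ s = id from funext hc, Finset.image_id]
  -- A fibre of `B` is the set of points that extend `τ` to a dominating set.
  have hfib : ∀ τ : Finset X, τ.card + 1 = Fintype.card I → τ.image c = Finset.univ.erase i₀ →
      (B.filter fun q => q.1 = τ).card =
        (Finset.univ.filter fun y => y ∉ τ ∧ Dominating h (insert y τ)).card := by
    intro τ h1 h2
    refine Finset.card_nbij' Prod.snd (fun x => (τ, x)) ?_ ?_ ?_ ?_
    · rintro ⟨σ', x⟩ hq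
      simp only [B, Finset.coe_filter, Finset.mem_filter, Finset.mem_univ, true_and,
        Set.mem_ofPred_eq] at hq ⊢
      obtain ⟨hq, rfl⟩ := hq
      exact ⟨hq.1, hq.2.2.1⟩
    · intro x hx
      simp only [B, Finset.coe_filter, Finset.mem_filter, Finset.mem_univ, true_and,
        Set.mem_ofPred_eq] at hx ⊢
      exact ⟨⟨hx.1, h1, hx.2, h2⟩, trivial⟩
    · rintro ⟨σ', x⟩ hq
      simp only [Finset.coe_filter, Set.mem_ofPred_eq] at hq ⊢
      rw [hq.2]
    · intro x hx; rfl
  have hmemτ₀ : ∀ j, j ≠ i₀ → s j ∈ τ₀ := fun j hj =>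
    Finset.mem_image_of_mem _ (Finset.mem_erase.2 ⟨hj, Finset.mem_univ _⟩)
  have hodd : Odd (B.filter fun q => q.1 = τ₀).card := by
    rw [hfib τ₀ hτ₀card hτ₀c]
    obtain ⟨t, ht⟩ := hT
    obtain ⟨u, hu, humax⟩ := (Finset.univ.filter fun y => y ∉ Set.range s).exists_max_image (h i₀)
      ⟨t, by simpa using ht⟩
    simp only [Finset.mem_filter, Finset.mem_univ, true_and] at hu humax
    have : (Finset.univ.filter fun y => y ∉ τ₀ ∧ Dominating h (insert y τ₀)) = {u} := by
      ext y
      simp only [Finset.mem_filter, Finset.mem_univ, true_and, Finset.mem_singleton]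
      constructor
      · rintro ⟨hy, hd⟩
        have hge : ∀ t, t ∉ Set.range s → h i₀ t ≤ h i₀ y := by
          intro t ht
          obtain ⟨i, hi⟩ := hd t
          have : i = i₀ := by
            by_contra hne
            exact ht ⟨i, hinj i (le_antisymm (hs i t)
              (hi _ (Finset.mem_insert_of_mem (hmemτ₀ i hne))))⟩
          subst this
          exact hi y (Finset.mem_insert_self _ _)
        have hyr : y ∉ Set.range s := by
          rintro ⟨j, rfl⟩
          by_cases hj : j = i₀
          · subst hj
            exact hu ⟨j, hinj j (le_antisymm (hs j u) (hge u hu))⟩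
          · exact hy (hmemτ₀ j hj)
        exact hinj i₀ (le_antisymm (humax y hyr) (hge u hu))
      · rintro rfl
        refine ⟨fun hy => ?_, fun z => ?_⟩
        · obtain ⟨j, -, rfl⟩ := Finset.mem_image.1 hy
          exact hu ⟨j, rfl⟩
        · by_cases hz : z ∈ Set.range s
          · obtain ⟨j, rfl⟩ := hz
            exact ⟨j, fun x _ => hs j x⟩
          · refine ⟨i₀, Finset.forall_mem_insert _ _ _ |>.2 ⟨humax z hz, fun x hx => ?_⟩⟩
            obtain ⟨j, hj, rfl⟩ := Finset.mem_image.1 hx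
            exact (hs' i₀ j z (Finset.mem_erase.1 hj).1.symm hz).le
    rw [this, Finset.card_singleton]
    exact odd_one
  have heven : ∀ τ ∈ Finset.univ.erase τ₀, Even (B.filter fun q => q.1 = τ).card := by
    intro τ hτne
    have hτne := (Finset.mem_erase.1 hτne).1
    rcases (B.filter fun q => q.1 = τ).eq_empty_or_nonempty with he | ⟨⟨τ', y⟩, hq⟩
    · rw [he]; exact Even.zero
    simp only [B, Finset.mem_filter, Finset.mem_univ, true_and] at hq
    obtain ⟨⟨hy, hcard, hdom, hcol⟩, rfl⟩ := hq
    rw [hfib τ' hcard hcol]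
    have hne : τ'.Nonempty := by
      rw [Finset.nonempty_iff_ne_empty]
      rintro rfl
      refine hτne ?_
      rw [eq_comm, ← Finset.card_eq_zero]
      rw [Finset.card_empty] at hcard
      omega
    refine even_card_dominating_insert hinj (hdom.mono (Finset.subset_insert _ _)) hne hcard ?_
    intro p hpτ hp k
    refine ⟨s k, fun i hik => ?_⟩
    by_contra! hle
    have hsub : τ' ⊆ (Finset.univ.erase i).image s := by
      intro x hx
      have hkx := hle.trans (hp i x hx)
      by_cases hxr : x ∈ Set.range s
      · obtain ⟨j, rfl⟩ := hxr
        refine Finset.mem_image_of_mem _ (Finset.mem_erase.2 ⟨?_, Finset.mem_univ _⟩)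
        rintro rfl
        exact hik (hsinj (hinj j (le_antisymm (hs j _) hkx)))
      · exact absurd (hs' i k x hik hxr) (not_lt.2 hkx)
    have heq : τ' = (Finset.univ.erase i).image s := by
      refine Finset.eq_of_subset_of_card_le hsub ?_
      rw [Finset.card_image_of_injective _ hsinj, Finset.card_erase_of_mem (Finset.mem_univ _),
        Finset.card_univ]
      omega
    have hii : i = i₀ := by
      by_contra hne'
      have : i ∈ τ'.image c := by
        rw [hcol]; exact Finset.mem_erase.2 ⟨hne', Finset.mem_univ _⟩
      rw [heq, Finset.image_image] at this
      obtain ⟨j, hj, hji⟩ := Finset.mem_image.1 this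
      rw [Function.comp_apply, hc] at hji
      exact (Finset.mem_erase.1 hj).1 hji
    subst hii
    exact hτne heq
  have hB : Odd B.card := by
    rw [Finset.card_eq_sum_card_fiberwise (f := Prod.fst) (t := Finset.univ) (by simp),
      ← Finset.add_sum_erase _ _ (Finset.mem_univ τ₀)]
    exact hodd.add_even (Finset.even_sum _ heven)
  exact Nat.not_even_iff_odd.2 hB (hAB ▸ hA)

end Combinatorial

section Simplex

variable {I : Type*} [Fintype I] [DecidableEq I]

lemma exists_coloured_dominating [Nonempty I] {T : Finset (I → ℕ)} (hT : T.Nonempty)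
    (c : (I → ℕ) → I) :
    ∃ σ ⊆ T, ∀ y ∈ T, ∃ i ∈ σ.image c, ∀ x ∈ σ, y i ≤ x i := by
  classical
  obtain ⟨e, he⟩ := exists_injective_nat (I → ℕ)
  obtain ⟨d, hd⟩ := exists_injective_nat I
  let h : I → T ⊕ I → ℕ ×ₗ ℕ ×ₗ ℕ := fun i => Sum.elim
    (fun t => toLex (1, toLex (t.1 i, e t.1)))
    (fun j => toLex (if i = j then 0 else 2, toLex (d j, 0)))
  have hinj : ∀ i, Function.Injective (h i) := by
    rintro i (⟨x, hx⟩ | j) (⟨y, hy⟩ | k) hxy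
    · simp only [h, Sum.elim_inl, toLex_inj, Prod.mk.injEq, true_and] at hxy
      simp only [he hxy.2]
    · simp only [h, Sum.elim_inl, Sum.elim_inr, toLex_inj, Prod.mk.injEq] at hxy
      have := hxy.1
      split_ifs at this; omega
    · simp only [h, Sum.elim_inl, Sum.elim_inr, toLex_inj, Prod.mk.injEq] at hxy
      have := hxy.1
      split_ifs at this; omega
    · simp only [h, Sum.elim_inr, toLex_inj, Prod.mk.injEq] at hxy
      rw [hd hxy.2.1]
  have hs : ∀ i y, h i (Sum.inr i) ≤ h i y := by
    rintro i (x | j)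
    · simp [h, Prod.Lex.toLex_le_toLex]
    · by_cases hij : i = j
      · subst hij; exact le_rfl
      · simp [h, Prod.Lex.toLex_le_toLex, hij]
  have hs' : ∀ i j y, i ≠ j → y ∉ Set.range (Sum.inr : I → T ⊕ I) →
      h i y < h i (Sum.inr j) := by
    rintro i j (x | k) hij hy
    · simp [h, Prod.Lex.toLex_lt_toLex, hij]
    · exact absurd ⟨k, rfl⟩ hy
  obtain ⟨t, ht⟩ := hT
  obtain ⟨ρ, hcard, hdom, hcol⟩ := exists_dominating_image_eq_univ hinj hs hs'
    ⟨Sum.inl ⟨t, ht⟩, by simp⟩ (c := Sum.elim (fun t => c t.1) id) (fun _ => rfl)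
  refine ⟨T.filter fun x => ∃ hx : x ∈ T, Sum.inl ⟨x, hx⟩ ∈ ρ, Finset.filter_subset _ _,
    fun y hy => ?_⟩
  obtain ⟨i, hi⟩ := hdom (Sum.inl ⟨y, hy⟩)
  refine ⟨i, ?_, ?_⟩
  · have : i ∈ ρ.image (Sum.elim (fun t => c t.1) id) := by rw [hcol]; exact Finset.mem_univ _
    obtain ⟨x | j, hx, hxi⟩ := Finset.mem_image.1 this
    · exact Finset.mem_image.2 ⟨x.1, Finset.mem_filter.2 ⟨x.2, x.2, hx⟩, hxi⟩
    · simp only [Sum.elim_inr, id] at hxi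
      subst hxi
      exact absurd (hinj j (le_antisymm (hi _ hx) (hs j _))) (by simp)
  · intro x hx
    obtain ⟨-, hxT, hxρ⟩ := Finset.mem_filter.1 hx
    have := hi _ hxρ
    simp only [h, Sum.elim_inl, Prod.Lex.toLex_le_toLex, lt_irrefl, true_and, false_or] at this
    rcases this with h1 | h1
    · exact h1.le
    · exact h1.1.le

/-- Discrete form of the Knaster–Kuratowski–Mazurkiewicz–Sperner covering theorem. -/
lemma exists_near_coloured [Nonempty I] (N : ℕ) (c : (I → ℕ) → I) :
    ∃ b : I → ℕ, ∑ i, b i = N ∧ ∀ i, b i ≤ Fintype.card I ∨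
      ∃ p : I → ℕ, ∑ j, p j = N ∧ c p = i ∧
        ∀ j, p j ≤ b j + Fintype.card I ∧ b j ≤ p j + Fintype.card I := by
  have hTmem : ∀ x : I → ℕ, x ∈ Finset.univ.piAntidiag N ↔ ∑ i, x i = N := fun x => by simp
  have hT : (Finset.univ.piAntidiag N : Finset (I → ℕ)).Nonempty :=
    ⟨Pi.single (Classical.arbitrary I) N, by simp⟩
  obtain ⟨σ, hσT, hσ⟩ := exists_coloured_dominating hT c
  set C := σ.image c with hC
  have hσne : σ.Nonempty := by
    obtain ⟨y, hy⟩ := hT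
    obtain ⟨i, hi, -⟩ := hσ y hy
    exact Finset.image_nonempty.1 ⟨i, hi⟩
  have hCne : C.Nonempty := hσne.image c
  choose p hpσ hp using fun i => σ.exists_min_image (fun x => x i) hσne
  have hlarge : N < ∑ i ∈ C, p i i + C.card := by
    by_contra! hle
    obtain ⟨i₀, hi₀⟩ := hCne
    let y : I → ℕ := fun i => (if i ∈ C then p i i + 1 else 0) +
      if i = i₀ then N - (∑ i ∈ C, p i i + C.card) else 0
    have hy : ∑ i, y i = N := by
      simp only [y, Finset.sum_add_distrib, Finset.sum_ite_mem, Finset.univ_inter,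
        Finset.sum_ite_eq', Finset.mem_univ, if_true, Finset.sum_const, smul_eq_mul, mul_one]
      omega
    obtain ⟨i, hiC, hi⟩ := hσ y ((hTmem y).2 hy)
    have := hi (p i) (hpσ i)
    simp only [y, hiC, if_true] at this
    omega
  have hCcard : C.card ≤ Fintype.card I := Finset.card_le_univ C
  have hsum : ∀ x ∈ σ, ∑ i ∈ C, x i + ∑ i ∈ Cᶜ, x i = N := fun x hx => by
    rw [Finset.sum_add_sum_compl]; exact (hTmem x).1 (hσT hx)
  have hin : ∀ x ∈ σ, ∀ i ∈ C, x i ≤ p i i + Fintype.card I := by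
    intro x hx i hi
    have h1 := hsum x hx
    have h2 : ∑ j ∈ C.erase i, p j j ≤ ∑ j ∈ C.erase i, x j :=
      Finset.sum_le_sum fun j _ => hp j x hx
    rw [← Finset.add_sum_erase _ _ hi] at h1 hlarge
    omega
  have hout : ∀ x ∈ σ, ∀ i ∉ C, x i ≤ Fintype.card I := by
    intro x hx i hi
    have h1 := hsum x hx
    have h2 : ∑ j ∈ C, p j j ≤ ∑ j ∈ C, x j := Finset.sum_le_sum fun j _ => hp j x hx
    have h3 : x i ≤ ∑ j ∈ Cᶜ, x j :=
      Finset.single_le_sum (fun _ _ => Nat.zero_le _) (Finset.mem_compl.2 hi)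
    omega
  have hnear : ∀ x ∈ σ, ∀ x' ∈ σ, ∀ i, x i ≤ x' i + Fintype.card I := by
    intro x hx x' hx' i
    by_cases hi : i ∈ C
    · have := hin x hx i hi
      have := hp i x' hx'
      omega
    · have := hout x hx i hi
      omega
  obtain ⟨b, hb⟩ := hσne
  refine ⟨b, (hTmem b).1 (hσT hb), fun i => ?_⟩
  by_cases hi : i ∈ C
  · obtain ⟨x, hx, rfl⟩ := Finset.mem_image.1 hi
    exact Or.inr ⟨x, (hTmem x).1 (hσT hx), rfl, fun j => ⟨hnear x hx b hb j, hnear b hb x hx j⟩⟩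
  · exact Or.inl (hout b hb i hi)

open Filter Topology in
/-- The **Knaster–Kuratowski–Mazurkiewicz–Sperner theorem**: if the sets `{G i ≤ 0}` cover the
simplex and `{G i ≤ 0}` contains the facet `x i = 0`, then they have a common point. -/
theorem exists_mem_stdSimplex_forall_nonpos [Nonempty I] {G : I → (I → ℝ) → ℝ}
    (hG : ∀ i, ContinuousOn (G i) (stdSimplex ℝ I))
    (hcover : ∀ x ∈ stdSimplex ℝ I, ∃ i, G i x ≤ 0)
    (hfacet : ∀ x ∈ stdSimplex ℝ I, ∀ i, x i = 0 → G i x ≤ 0) :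
    ∃ x ∈ stdSimplex ℝ I, ∀ i, G i x ≤ 0 := by
  classical
  let r : ℕ → (I → ℕ) → I → ℝ := fun k b i => b i / (k + 1 : ℝ)
  have hr : ∀ k b, ∑ i, b i = k + 1 → r k b ∈ stdSimplex ℝ I := by
    intro k b hb
    refine ⟨fun i => by positivity, ?_⟩
    simp only [r]
    rw [← Finset.sum_div, div_eq_one_iff_eq (by positivity)]
    exact_mod_cast hb
  have hcol : ∀ k b, ∃ i, ∑ i, b i = k + 1 → G i (r k b) ≤ 0 := by
    intro k b
    by_cases hb : ∑ i, b i = k + 1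
    · exact (hcover _ (hr k b hb)).imp fun i hi _ => hi
    · exact ⟨Classical.arbitrary I, fun h => absurd h hb⟩
  choose c hc using hcol
  choose b hb hbi using fun k : ℕ => exists_near_coloured (k + 1) (c k)
  obtain ⟨x, hx, φ, hφ, hlim⟩ := (isCompact_stdSimplex (𝕜 := ℝ) (ι := I)).tendsto_subseq
    (fun k => hr k (b k) (hb k))
  have hzero : Tendsto (fun k : ℕ => (Fintype.card I : ℝ) / ((φ k : ℝ) + 1)) atTop (𝓝 0) :=
    ((tendsto_const_div_atTop_nhds_zero_nat (Fintype.card I : ℝ)).comp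
      (tendsto_add_atTop_nat 1)).comp hφ.tendsto_atTop |>.congr fun k => by simp
  refine ⟨x, hx, fun i => ?_⟩
  by_cases hfreq : ∃ᶠ k in atTop, b (φ k) i ≤ Fintype.card I
  · refine hfacet x hx i (le_antisymm ?_ (hx.1 i))
    have h1 : Tendsto (fun k => r (φ k) (b (φ k)) i) atTop (𝓝 (x i)) :=
      (tendsto_pi_nhds.1 hlim) i
    have h2 := h1.sub hzero
    rw [sub_zero] at h2
    refine le_of_tendsto_of_frequently h2 ?_
    refine hfreq.mono fun k hk => ?_
    simp only [r]
    rw [sub_nonpos]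
    gcongr
  · rw [not_frequently] at hfreq
    have hex : ∀ k, ∃ p : I → ℕ, ¬ b (φ k) i ≤ Fintype.card I →
        ∑ j, p j = φ k + 1 ∧ c (φ k) p = i ∧ ∀ j, p j ≤ b (φ k) j + Fintype.card I ∧
          b (φ k) j ≤ p j + Fintype.card I := by
      intro k
      by_cases hk : b (φ k) i ≤ Fintype.card I
      · exact ⟨0, fun h => absurd hk h⟩
      · exact ((hbi (φ k) i).resolve_left hk).imp fun p hp _ => hp
    choose p hp using hex
    have hplim : Tendsto (fun k => r (φ k) (p k)) atTop (𝓝 x) := by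
      rw [tendsto_pi_nhds]
      intro j
      have h1 : Tendsto (fun k => r (φ k) (b (φ k)) j) atTop (𝓝 (x j)) :=
        (tendsto_pi_nhds.1 hlim) j
      refine h1.congr_dist (squeeze_zero' (.of_forall fun _ => dist_nonneg) ?_ hzero)
      filter_upwards [hfreq] with k hk
      have h2 := (hp k hk).2.2 j
      simp only [r]
      rw [Real.dist_eq, ← sub_div, abs_div, abs_of_pos (show (0 : ℝ) < φ k + 1 by positivity)]
      gcongr
      rw [abs_sub_le_iff]
      constructor
      · rw [sub_le_iff_le_add']; exact_mod_cast h2.2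
      · rw [sub_le_iff_le_add']; exact_mod_cast h2.1
    have hmem : ∀ᶠ k in atTop, r (φ k) (p k) ∈ stdSimplex ℝ I := by
      filter_upwards [hfreq] with k hk
      exact hr _ _ (hp k hk).1
    refine le_of_tendsto (((hG i) x hx).tendsto.comp
      (tendsto_nhdsWithin_iff.2 ⟨hplim, hmem⟩)) ?_
    filter_upwards [hfreq] with k hk
    have := hc (φ k) (p k) (hp k hk).1
    rwa [(hp k hk).2.1] at this

end Simplex

section Gaussian

variable {m : ℕ}

lemma euclNorm_le_sqrt_mul_norm (x : Fin m → ℝ) : euclNorm x ≤ √m * ‖x‖ := by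
  unfold euclNorm
  rw [Real.sqrt_le_iff]
  refine ⟨by positivity, ?_⟩
  rw [mul_pow, Real.sq_sqrt (Nat.cast_nonneg m)]
  calc ∑ i, x i ^ 2 ≤ ∑ _i : Fin m, ‖x‖ ^ 2 := by
        refine Finset.sum_le_sum fun i _ => ?_
        rw [← sq_abs (x i)]
        exact pow_le_pow_left₀ (abs_nonneg _) (norm_le_pi_norm x i) 2
    _ = m * ‖x‖ ^ 2 := by simp

lemma lipschitzWith_of_euclNorm {f : (Fin m → ℝ) → ℝ} {L : ℝ}
    (hLip : ∀ x y, |f x - f y| ≤ L * euclNorm (x - y)) :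
    LipschitzWith (NNReal.mk (|L| * √m) (by positivity)) f := by
  refine LipschitzWith.of_dist_le_mul fun x y => ?_
  rw [Real.dist_eq, dist_eq_norm, NNReal.coe_mk, mul_assoc]
  calc |f x - f y| ≤ L * euclNorm (x - y) := hLip x y
    _ ≤ |L| * euclNorm (x - y) := by
        gcongr
        · exact Real.sqrt_nonneg _
        · exact le_abs_self L
    _ ≤ |L| * (√m * ‖x - y‖) := by
        gcongr
        exact euclNorm_le_sqrt_mul_norm _

lemma abs_partialDeriv_le {f : (Fin m → ℝ) → ℝ} {K : NNReal} (hf : LipschitzWith K f) (j : Fin m)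
    (x : Fin m → ℝ) : |partialDeriv f j x| ≤ K := by
  have h := (fderiv ℝ f x).le_of_opNorm_le (norm_fderiv_le_of_lipschitz ℝ hf) (Pi.single j 1)
  simpa [Pi.norm_single, partialDeriv] using h

lemma fderiv_apply_eq_sum_partialDeriv (g : (Fin m → ℝ) → ℝ) (x v : Fin m → ℝ) :
    fderiv ℝ g x v = ∑ j, v j * partialDeriv g j x := by
  conv_lhs => rw [pi_eq_sum_univ' v, map_sum]
  refine Finset.sum_congr rfl fun j _ => ?_
  rw [map_smul, smul_eq_mul]
  rfl

lemma sum_abs_partialDeriv_le {g : (Fin m → ℝ) → ℝ} {t : ℝ} (ht : 0 ≤ t)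
    (hg : ∀ x y, |g x - g y| ≤ t * ‖x - y‖) (x : Fin m → ℝ) :
    ∑ j, |partialDeriv g j x| ≤ t := by
  have hlip : LipschitzWith (NNReal.mk t ht) g := LipschitzWith.of_dist_le_mul fun x y => by
    rw [Real.dist_eq, dist_eq_norm]; exact hg x y
  let v : Fin m → ℝ := fun j => SignType.sign (partialDeriv g j x)
  have hv : ‖v‖ ≤ 1 := by
    refine (pi_norm_le_iff_of_nonneg zero_le_one).2 fun j => ?_
    simp only [v]
    rcases SignType.sign (partialDeriv g j x) <;> simp
  have hsum : ∑ j, |partialDeriv g j x| = fderiv ℝ g x v := by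
    rw [fderiv_apply_eq_sum_partialDeriv]
    exact Finset.sum_congr rfl fun j _ => (sign_mul_self (partialDeriv g j x)).symm
  rw [hsum]
  calc fderiv ℝ g x v ≤ ‖fderiv ℝ g x v‖ := le_abs_self _
    _ ≤ t * ‖v‖ := (fderiv ℝ g x).le_of_opNorm_le (norm_fderiv_le_of_lipschitz ℝ hlip) v
    _ ≤ t := mul_le_of_le_one_right ht hv

lemma fderiv_comp_mul {f : (Fin m → ℝ) → ℝ} (hf : Differentiable ℝ f) (l x v : Fin m → ℝ) :
    fderiv ℝ (fun y => f (fun k => l k * y k)) x v =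
      fderiv ℝ f (fun k => l k * x k) (fun k => l k * v k) := by
  let D : (Fin m → ℝ) →L[ℝ] (Fin m → ℝ) := ContinuousLinearMap.mul ℝ (Fin m → ℝ) l
  have h := (hf (D x)).hasFDerivAt.comp x D.hasFDerivAt
  exact congrArg (fun φ => φ v) h.fderiv

lemma partialDeriv_comp_mul {f : (Fin m → ℝ) → ℝ} (hf : Differentiable ℝ f) (l : Fin m → ℝ)
    (j : Fin m) (x : Fin m → ℝ) :
    partialDeriv (fun y => f (fun k => l k * y k)) j x =
      l j * partialDeriv f j (fun k => l k * x k) := by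
  unfold partialDeriv
  rw [fderiv_comp_mul hf, ← smul_eq_mul, ← map_smul]
  congr 1
  ext k
  by_cases hk : k = j
  · subst hk; simp
  · simp [hk]

lemma continuous_partialDeriv {f : (Fin m → ℝ) → ℝ} (hf : ContDiff ℝ 1 f) (j : Fin m) :
    Continuous (partialDeriv f j) :=
  (hf.continuous_fderiv one_ne_zero).clm_apply continuous_const

instance : IsProbabilityMeasure (stdGaussian m) := by
  unfold _root_.stdGaussian; infer_instance

instance : (stdGaussian m).IsOpenPosMeasure := by
  have : (gaussianReal 0 1).IsOpenPosMeasure :=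
    (gaussianReal_absolutelyContinuous' 0 one_ne_zero).isOpenPosMeasure
  unfold _root_.stdGaussian; infer_instance

/-- The map `l ↦ ‖(∂ⱼ f) ∘ diag l‖_{L¹(γ_m)}`. -/
noncomputable def gaussianMeanPartial (f : (Fin m → ℝ) → ℝ) (j : Fin m) (l : Fin m → ℝ) : ℝ :=
  ∫ x, |partialDeriv f j (fun k => l k * x k)| ∂stdGaussian m

lemma gaussianMeanPartial_nonneg (f : (Fin m → ℝ) → ℝ) (j : Fin m) (l : Fin m → ℝ) :
    0 ≤ gaussianMeanPartial f j l := integral_nonneg fun _ => abs_nonneg _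

lemma continuous_abs_partialDeriv_mul {f : (Fin m → ℝ) → ℝ} (hf : ContDiff ℝ 1 f) (j : Fin m) :
    Continuous fun q : (Fin m → ℝ) × (Fin m → ℝ) =>
      |partialDeriv f j (fun k => q.1 k * q.2 k)| :=
  ((continuous_partialDeriv hf j).comp (by fun_prop)).abs

lemma integrable_abs_partialDeriv {f : (Fin m → ℝ) → ℝ} {K : NNReal} (hf : ContDiff ℝ 1 f)
    (hK : LipschitzWith K f) (j : Fin m) (l : Fin m → ℝ) :
    Integrable (fun x => |partialDeriv f j (fun k => l k * x k)|) (stdGaussian m) := by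
  refine Integrable.of_bound (C := K)
    ((continuous_abs_partialDeriv_mul hf j).comp (.prodMk_right l)).aestronglyMeasurable
    (.of_forall fun x => ?_)
  rw [Real.norm_eq_abs, abs_abs]
  exact abs_partialDeriv_le hK _ _

lemma continuous_gaussianMeanPartial {f : (Fin m → ℝ) → ℝ} {K : NNReal} (hf : ContDiff ℝ 1 f)
    (hK : LipschitzWith K f) (j : Fin m) : Continuous (gaussianMeanPartial f j) := by
  refine continuous_of_dominated (bound := fun _ => (K : ℝ))
    (fun l => (integrable_abs_partialDeriv hf hK j l).aestronglyMeasurable)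
    (fun l => .of_forall fun x => ?_) (integrable_const _) (.of_forall fun x => ?_)
  · rw [Real.norm_eq_abs, abs_abs]
    exact abs_partialDeriv_le hK _ _
  · exact (continuous_abs_partialDeriv_mul hf j).comp (.prodMk_left x)

/-- If all the mean partial derivatives of `f ∘ diag l` vanish, then `f` is constant on the
coordinate subspace on which `l` is supported. -/
lemma eq_of_forall_gaussianMeanPartial_eq_zero {f : (Fin m → ℝ) → ℝ} {K : NNReal}
    (hf : ContDiff ℝ 1 f) (hK : LipschitzWith K f) {l : Fin m → ℝ}
    (hl : ∀ j, l j * gaussianMeanPartial f j l = 0) {x y : Fin m → ℝ}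
    (hx : ∀ i, l i = 0 → x i = 0) (hy : ∀ i, l i = 0 → y i = 0) : f x = f y := by
  have hdf := hf.differentiable one_ne_zero
  have hzero : ∀ j (z : Fin m → ℝ), l j * partialDeriv f j (fun k => l k * z k) = 0 := by
    intro j z
    rcases mul_eq_zero.1 (hl j) with h | h
    · rw [h, zero_mul]
    · unfold gaussianMeanPartial at h
      rw [integral_eq_zero_iff_of_nonneg (fun _ => abs_nonneg _)
        (integrable_abs_partialDeriv hf hK j l)] at h
      have h2 := (Continuous.ae_eq_iff_eq (stdGaussian m)
        ((continuous_abs_partialDeriv_mul hf j).comp (.prodMk_right l)) continuous_const).1 h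
      rw [abs_eq_zero.1 (congrFun h2 z), mul_zero]
  have hconst := is_const_of_fderiv_eq_zero (𝕜 := ℝ) (f := fun z => f (fun k => l k * z k))
    (hdf.comp (by fun_prop)) (fun z => by
      ext v
      rw [fderiv_apply_eq_sum_partialDeriv]
      exact Finset.sum_eq_zero fun j _ =>
        mul_eq_zero_of_right _ ((partialDeriv_comp_mul hdf l j z).trans (hzero j z)))
    (fun k => x k / l k) (fun k => y k / l k)
  have hdiv : ∀ w : Fin m → ℝ, (∀ i, l i = 0 → w i = 0) → (fun k => l k * (w k / l k)) = w :=
    fun w hw => funext fun k => mul_div_cancel_of_imp' (hw k)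
  simpa only [hdiv x hx, hdiv y hy] using hconst

/-- The total Gaussian mean of the partial derivatives is at most the Lipschitz constant. -/
lemma sum_integral_abs_partialDeriv_le_lipConstInf {g : (Fin m → ℝ) → ℝ} {K : NNReal}
    (hK : LipschitzWith K g)
    (hgi : ∀ j, Integrable (fun x => |partialDeriv g j x|) (stdGaussian m)) :
    ∑ j, ∫ x, |partialDeriv g j x| ∂stdGaussian m ≤ lipConstInf g := by
  refine le_csInf ⟨K + 1, by positivity, fun x y => ?_⟩ ?_
  · have := hK.dist_le_mul x y
    rw [Real.dist_eq, dist_eq_norm] at this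
    nlinarith [norm_nonneg (x - y)]
  · rintro t ⟨ht, hg⟩
    rw [← integral_finsetSum _ fun j _ => hgi j]
    calc ∫ x, ∑ j, |partialDeriv g j x| ∂stdGaussian m ≤ ∫ _, t ∂stdGaussian m :=
          integral_mono (integrable_finsetSum _ fun j _ => hgi j) (integrable_const _)
            (sum_abs_partialDeriv_le ht.le hg)
      _ = t := by simp

end Gaussian

/-- For a `C¹`-smooth Lipschitz `f : ℝᵐ → ℝ` which is not constant on any proper
coordinate subspace, there are `λ₁,…,λ_m > 0` with `Σ λᵢ² = 1` such that, with
`Λ = diag(λ)`, `‖∂ⱼ(f∘Λ)‖_{L¹(γ_m)} ≤ a(f∘Λ)/m` for every `j`. -/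
theorem statement9 (m : ℕ) (hm : 1 ≤ m) (f : (Fin m → ℝ) → ℝ)
    (hf : ContDiff ℝ 1 f) (L : ℝ)
    (hLip : ∀ x y, |f x - f y| ≤ L * euclNorm (x - y))
    (hnc : ∀ σ : Finset (Fin m), σ.Nonempty → σ ≠ Finset.univ →
      ∃ x y : Fin m → ℝ, (∀ i ∉ σ, x i = 0) ∧ (∀ i ∉ σ, y i = 0) ∧ f x ≠ f y) :
    ∃ l : Fin m → ℝ, (∀ i, 0 < l i) ∧ ∑ i, (l i) ^ 2 = 1 ∧
      ∀ j : Fin m,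
        ∫ x, |partialDeriv (fun y => f (fun k => l k * y k)) j x| ∂stdGaussian m
          ≤ (1 / m) * lipConstInf (fun y => f (fun k => l k * y k)) := by
  have hK := lipschitzWith_of_euclNorm hLip
  have hdf := hf.differentiable one_ne_zero
  have : Nonempty (Fin m) := ⟨⟨0, hm⟩⟩
  have hm0 : (0 : ℝ) < m := by exact_mod_cast hm
  let F : Fin m → (Fin m → ℝ) → ℝ := fun j p =>
    √(p j) * gaussianMeanPartial f j fun k => √(p k)
  have hF0 : ∀ j p, 0 ≤ F j p := fun j p =>
    mul_nonneg (Real.sqrt_nonneg _) (gaussianMeanPartial_nonneg _ _ _)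
  have hFcont : ∀ j, Continuous (F j) := fun j =>
    (by fun_prop : Continuous fun p : Fin m → ℝ => √(p j)).mul
      ((continuous_gaussianMeanPartial hf hK j).comp (by fun_prop))
  obtain ⟨p, hp, hle⟩ := exists_mem_stdSimplex_forall_nonpos
    (G := fun i p => F i p - (1 / m) * ∑ j, F j p)
    (fun i => ((hFcont i).sub
      (continuous_const.mul (continuous_finsetSum _ fun j _ => hFcont j))).continuousOn)
    (fun p _ => by
      obtain ⟨i, -, hi⟩ := Finset.exists_le_of_sum_le (s := Finset.univ) (f := fun i => F i p)
        (g := fun _ => (1 / m) * ∑ j, F j p) Finset.univ_nonempty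
        (le_of_eq (by simp [mul_inv_cancel_left₀ hm0.ne']))
      exact ⟨i, sub_nonpos.2 hi⟩)
    (fun p _ i hi => by
      have : F i p = 0 := by simp [F, hi]
      rw [this, zero_sub, neg_nonpos]
      exact mul_nonneg (by positivity) (Finset.sum_nonneg fun j _ => hF0 j p))
  simp only [sub_nonpos] at hle
  have hpos : ∀ i, 0 < p i := by
    by_contra! hcon
    obtain ⟨i, hi⟩ := hcon
    have hi0 : p i = 0 := le_antisymm hi (hp.1 i)
    have hFi : F i p = 0 := by simp [F, hi0]
    -- all the `F j p` equal their average, which therefore vanishes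
    have heq : ∀ j ∈ Finset.univ, F j p = (1 / m) * ∑ j, F j p :=
      (Finset.sum_eq_sum_iff_of_le fun j _ => hle j).1
        (by simp [mul_inv_cancel_left₀ hm0.ne'])
    have hFzero : ∀ j, F j p = 0 := fun j => by
      rw [heq j (Finset.mem_univ _), ← heq i (Finset.mem_univ _), hFi]
    have hsupp : ∃ j, p j ≠ 0 := by
      by_contra! h
      have := hp.2
      simp [h] at this
    obtain ⟨j, hj⟩ := hsupp
    obtain ⟨x, y, hx, hy, hxy⟩ := hnc (Finset.univ.filter fun k => p k ≠ 0) ⟨j, by simpa using hj⟩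
      (fun h => by simpa [hi0] using h.ge (Finset.mem_univ i))
    have hsqrt : ∀ k, √(p k) = 0 → k ∉ Finset.univ.filter fun k => p k ≠ 0 := fun k hk => by
      simpa using (Real.sqrt_eq_zero (hp.1 k)).1 hk
    exact hxy (eq_of_forall_gaussianMeanPartial_eq_zero hf hK (l := fun k => √(p k)) hFzero
      (fun k hk => hx k (hsqrt k hk)) (fun k hk => hy k (hsqrt k hk)))
  have habs : ∀ j x, |partialDeriv (fun y => f (fun k => √(p k) * y k)) j x| =
      √(p j) * |partialDeriv f j (fun k => √(p k) * x k)| := fun j x => by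
    rw [partialDeriv_comp_mul hdf, abs_mul, abs_of_nonneg (Real.sqrt_nonneg _)]
  have hFint : ∀ j, ∫ x, |partialDeriv (fun y => f (fun k => √(p k) * y k)) j x| ∂stdGaussian m =
      F j p := fun j => by
    simp only [habs, integral_const_mul]
    rfl
  have hlipg : LipschitzWith _ fun y : Fin m → ℝ => f (fun k => √(p k) * y k) :=
    hK.comp (ContinuousLinearMap.mul ℝ (Fin m → ℝ) fun k => √(p k)).lipschitz
  refine ⟨fun k => √(p k), fun i => Real.sqrt_pos.2 (hpos i), ?_, fun j => ?_⟩
  · simp only [Real.sq_sqrt (hp.1 _)]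
    exact hp.2
  · rw [hFint j]
    refine (hle j).trans (mul_le_mul_of_nonneg_left ?_ (by positivity))
    have hsum := sum_integral_abs_partialDeriv_le_lipConstInf hlipg fun j => by
      simp only [habs]
      exact (integrable_abs_partialDeriv hf hK j _).const_mul _
    simpa only [hFint] using hsum
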